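/- Let n ≥ 1 and let 1 ≤ k ≤ r be integers. There is a constant C depending only on n and r such that for every u ∈ C_c^∞(ℝⁿ): Σ_{j=0}^{k} ‖∇^j u‖_{L^{2r/k}(ℝⁿ)} ≤ C ‖u‖_{L^∞(ℝⁿ)}^{1−k/r} (Σ_{i=0}^{r} ‖∇^i u‖_{L²(ℝⁿ)})^{k/r}. -/

import Mathlib

open MeasureTheory Finset

/-- A log-convex sequence up to the factor `K` is bounded at its second to last index by its two
extreme values. -/
lemma exists_pow_succ_le_of_sq_le {K : ℝ} (hK : 0 < K) (m : ℕ) :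
    ∃ C > 0, ∀ b : ℕ → ℝ, (∀ i, 0 ≤ b i) →
      (∀ i, i + 1 ≤ m → b (i + 1) ^ 2 ≤ K * (b i * b (i + 2))) →
      b m ^ (m + 1) ≤ C * (b 0 * b (m + 1) ^ m) := by
  induction m with
  | zero => exact ⟨1, one_pos, fun b _ _ => by simp⟩
  | succ m ih =>
    obtain ⟨C, hC, h⟩ := ih
    refine ⟨K ^ (m + 1) * C, by positivity, fun b hb hcond => ?_⟩
    have hm := h b hb fun i hi => hcond i (by omega)
    rcases (hb (m + 1)).eq_or_lt with h0 | hpos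
    · rw [← h0, zero_pow (by omega)]
      have := hb 0
      have := hb (m + 1 + 1)
      positivity
    · have hsq := pow_le_pow_left₀ (by positivity) (hcond m le_rfl) (m + 1)
      refine le_of_mul_le_mul_left ?_ (pow_pos hpos m)
      calc b (m + 1) ^ m * b (m + 1) ^ (m + 1 + 1) = (b (m + 1) ^ 2) ^ (m + 1) := by ring
        _ ≤ (K * (b m * b (m + 2))) ^ (m + 1) := hsq
        _ = K ^ (m + 1) * b (m + 2) ^ (m + 1) * b m ^ (m + 1) := by ring
        _ ≤ K ^ (m + 1) * b (m + 2) ^ (m + 1) * (C * (b 0 * b (m + 1) ^ m)) := by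
          have := hb (m + 2)
          gcongr
        _ = _ := by ring

/-- A log-convex sequence up to the factor `K` is bounded by the geometric interpolation of its
extreme values. -/
lemma exists_le_rpow_mul_rpow_of_sq_le {K : ℝ} (hK : 0 < K) {j m : ℕ} (hj : 1 ≤ j) (hjm : j ≤ m) :
    ∃ C > 0, ∀ b : ℕ → ℝ, (∀ i, 0 ≤ b i) →
      (∀ i, i + 2 ≤ m → b (i + 1) ^ 2 ≤ K * (b i * b (i + 2))) →
      b j ≤ C * (b 0 ^ (1 - (j : ℝ) / m) * b m ^ ((j : ℝ) / m)) := by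
  induction m, hjm using Nat.le_induction with
  | base =>
    refine ⟨1, one_pos, fun b _ _ => ?_⟩
    have : (j : ℝ) ≠ 0 := by positivity
    simp [this]
  | succ m hjm ih =>
    obtain ⟨C, hC, h⟩ := ih
    obtain ⟨D, hD, h'⟩ := exists_pow_succ_le_of_sq_le hK m
    have hm0 : (0 : ℝ) < m := by exact_mod_cast (by omega : 0 < m)
    refine ⟨C * (D ^ (1 / ((m : ℝ) + 1))) ^ ((j : ℝ) / m), by positivity, fun b hb hcond => ?_⟩
    have h1 := h b hb fun i hi => hcond i (by omega)
    have h2 := h' b hb fun i hi => hcond i (by omega)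
    have b0 := hb 0
    have b1 := hb m
    have b2 := hb (m + 1)
    have h3 : b m ≤ D ^ (1 / ((m : ℝ) + 1)) *
        (b 0 ^ (1 / ((m : ℝ) + 1)) * b (m + 1) ^ ((m : ℝ) / ((m : ℝ) + 1))) := by
      have := Real.rpow_le_rpow (by positivity) h2 (by positivity : 0 ≤ 1 / ((m : ℝ) + 1))
      rw [Real.mul_rpow hD.le (by positivity), Real.mul_rpow b0 (by positivity),
        ← Real.rpow_natCast, ← Real.rpow_natCast, ← Real.rpow_mul b1, ← Real.rpow_mul b2] at this
      convert this using 2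
      · push_cast
        rw [mul_one_div_cancel (by positivity), Real.rpow_one]
      · congr 2
        ring
    calc b j ≤ C * (b 0 ^ (1 - (j : ℝ) / m) * b m ^ ((j : ℝ) / m)) := h1
      _ ≤ C * (b 0 ^ (1 - (j : ℝ) / m) * (D ^ (1 / ((m : ℝ) + 1)) *
        (b 0 ^ (1 / ((m : ℝ) + 1)) * b (m + 1) ^ ((m : ℝ) / ((m : ℝ) + 1)))) ^ ((j : ℝ) / m)) := by
          gcongr
      _ = C * (D ^ (1 / ((m : ℝ) + 1))) ^ ((j : ℝ) / m) *
          ((b 0 ^ (1 - (j : ℝ) / m) * b 0 ^ ((1 / ((m : ℝ) + 1)) * ((j : ℝ) / m))) *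
            b (m + 1) ^ (((m : ℝ) / ((m : ℝ) + 1)) * ((j : ℝ) / m))) := by
          rw [Real.mul_rpow (by positivity) (by positivity),
            Real.mul_rpow (by positivity) (by positivity), Real.rpow_mul b0, Real.rpow_mul b2]
          ring
      _ = _ := by
          have hj1 : (j : ℝ) / m ≤ 1 := by
            rw [div_le_one hm0]
            exact_mod_cast hjm
          rw [← Real.rpow_add_of_nonneg b0 (by linarith) (by positivity)]
          push_cast
          have e1 : 1 - (j : ℝ) / m + 1 / ((m : ℝ) + 1) * ((j : ℝ) / m) = 1 - j / ((m : ℝ) + 1) := by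
            field_simp
            ring
          have e2 : (m : ℝ) / ((m : ℝ) + 1) * ((j : ℝ) / m) = j / ((m : ℝ) + 1) := by
            field_simp
          rw [e1, e2]

/-- Hölder's inequality for three integrable functions with weights summing to one. -/
lemma integral_rpow_mul_rpow_mul_rpow_le {α : Type*} [MeasurableSpace α] {μ : Measure α}
    {f g h : α → ℝ} (hf : Integrable f μ) (hg : Integrable g μ) (hh : Integrable h μ)
    (hf0 : ∀ x, 0 ≤ f x) (hg0 : ∀ x, 0 ≤ g x) (hh0 : ∀ x, 0 ≤ h x) {a b c : ℝ}
    (ha : 0 ≤ a) (hb : 0 ≤ b) (hc : 0 ≤ c) (habc : a + b + c = 1) :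
    ∫ x, f x ^ a * g x ^ b * h x ^ c ∂μ ≤
      (∫ x, f x ∂μ) ^ a * (∫ x, g x ∂μ) ^ b * (∫ x, h x ∂μ) ^ c := by
  have If : 0 ≤ ∫ x, f x ∂μ := integral_nonneg hf0
  have Ig : 0 ≤ ∫ x, g x ∂μ := integral_nonneg hg0
  have Ih : 0 ≤ ∫ x, h x ∂μ := integral_nonneg hh0
  have hn : ∀ x, 0 ≤ f x ^ a * g x ^ b * h x ^ c := fun x => by
    have := hf0 x
    have := hg0 x
    have := hh0 x
    positivity
  rw [integral_eq_lintegral_of_nonneg_ae (Filter.Eventually.of_forall hn)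
    (((hf.aemeasurable.pow_const a).mul (hg.aemeasurable.pow_const b)).mul
      (hh.aemeasurable.pow_const c)).aestronglyMeasurable]
  refine ENNReal.toReal_le_of_le_ofReal (by positivity) ?_
  have key := ENNReal.lintegral_prod_norm_pow_le (μ := μ) (univ : Finset (Fin 3))
    (f := ![fun x => ENNReal.ofReal (f x), fun x => ENNReal.ofReal (g x),
      fun x => ENNReal.ofReal (h x)])
    (by
      intro i _
      fin_cases i
      exacts [hf.aemeasurable.ennreal_ofReal, hg.aemeasurable.ennreal_ofReal,
        hh.aemeasurable.ennreal_ofReal])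
    (p := ![a, b, c]) (by simpa [Fin.sum_univ_three] using habc)
    (by intro i _; fin_cases i <;> assumption)
  simp only [Fin.prod_univ_three, Matrix.cons_val_zero, Matrix.cons_val_one,
    Matrix.cons_val] at key
  rw [ENNReal.ofReal_mul (by positivity), ENNReal.ofReal_mul (by positivity),
    ← ENNReal.ofReal_rpow_of_nonneg If ha, ← ENNReal.ofReal_rpow_of_nonneg Ig hb,
    ← ENNReal.ofReal_rpow_of_nonneg Ih hc,
    ofReal_integral_eq_lintegral_ofReal hf (Filter.Eventually.of_forall hf0),
    ofReal_integral_eq_lintegral_ofReal hg (Filter.Eventually.of_forall hg0),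
    ofReal_integral_eq_lintegral_ofReal hh (Filter.Eventually.of_forall hh0)]
  refine le_trans (le_of_eq (lintegral_congr fun x => ?_)) key
  have hfx := hf0 x
  have hgx := hg0 x
  have hhx := hh0 x
  rw [ENNReal.ofReal_mul (by positivity), ENNReal.ofReal_mul (by positivity),
    ← ENNReal.ofReal_rpow_of_nonneg hfx ha, ← ENNReal.ofReal_rpow_of_nonneg hgx hb,
    ← ENNReal.ofReal_rpow_of_nonneg hhx hc]

/-- The operator norm of a multilinear form on `ℝⁿ` is at most the sum of its absolute coefficients
in the standard basis. -/
lemma norm_le_sum_norm_apply_basisFun {n m : ℕ}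
    (T : ContinuousMultilinearMap ℝ (fun _ : Fin m => EuclideanSpace ℝ (Fin n)) ℝ) :
    ‖T‖ ≤ ∑ α : Fin m → Fin n, |T fun i => EuclideanSpace.basisFun (Fin n) ℝ (α i)| := by
  refine ContinuousMultilinearMap.opNorm_le_bound (by positivity) fun v => ?_
  have hv : T v = ∑ α : Fin m → Fin n,
      T fun i => v i (α i) • EuclideanSpace.basisFun (Fin n) ℝ (α i) := by
    rw [← T.map_sum fun i k => v i k • EuclideanSpace.basisFun (Fin n) ℝ k]
    congr 1
    ext1 i
    exact ((EuclideanSpace.basisFun (Fin n) ℝ).sum_repr (v i)).symm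
  rw [hv, sum_mul]
  refine (norm_sum_le _ _).trans (sum_le_sum fun α _ => ?_)
  rw [ContinuousMultilinearMap.map_smul_univ, norm_smul, norm_prod, mul_comm, Real.norm_eq_abs]
  gcongr with i
  exact PiLp.norm_apply_le (v i) (α i)

lemma hasDerivAt_abs_rpow_mul_self {s : ℝ} (hs : 0 < s) (x : ℝ) :
    HasDerivAt (fun y : ℝ => |y| ^ s * y) ((s + 1) * |x| ^ s) x := by
  rcases eq_or_ne x 0 with rfl | hx
  · rw [hasDerivAt_iff_tendsto_slope]
    have hc : Continuous fun y : ℝ => |y| ^ s := continuous_abs.rpow_const fun _ => Or.inr hs.le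
    have := (hc.tendsto 0).mono_left (nhdsWithin_le_nhds (s := {0}ᶜ))
    simp only [abs_zero, Real.zero_rpow hs.ne', mul_zero] at this ⊢
    refine this.congr' ?_
    filter_upwards [self_mem_nhdsWithin] with y hy
    have hy : y ≠ 0 := hy
    simp [slope_def_field, hy]
  · have h1 : HasDerivAt (fun y : ℝ => |y| ^ s) (SignType.sign x * s * |x| ^ (s - 1)) x :=
      (hasDerivAt_abs hx).rpow_const (Or.inl (abs_ne_zero.2 hx))
    convert! h1.mul (hasDerivAt_id x) using 1
    have : |x| ^ s = |x| ^ (s - 1) * |x| := by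
      rw [← Real.rpow_add_one (abs_ne_zero.2 hx), sub_add_cancel]
    rw [this, id]
    linear_combination (-s * |x| ^ (s - 1)) * sign_mul_self x

/-- Integrating `|∂f|ᵖ` by parts moves one derivative from one factor to the others. -/
lemma integral_abs_rpow_le_of_fderiv {E : Type*} [NormedAddCommGroup E] [NormedSpace ℝ E]
    [FiniteDimensional ℝ E] [MeasurableSpace E] [BorelSpace E] {μ : Measure E}
    [μ.IsAddHaarMeasure] {f g h : E → ℝ} {y : E} (hf : Differentiable ℝ f)
    (hg : Differentiable ℝ g) (hh : Continuous h) (hfg : ∀ x, fderiv ℝ f x y = g x)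
    (hgh : ∀ x, fderiv ℝ g x y = h x) (hfs : HasCompactSupport f) {p : ℝ} (hp : 2 < p) :
    ∫ x, |g x| ^ p ∂μ ≤ (p - 1) * ∫ x, |f x| * |g x| ^ (p - 2) * |h x| ∂μ := by
  set G : E → ℝ := fun x => |g x| ^ (p - 2) * g x with hG
  have hGd : ∀ x, HasFDerivAt G (((p - 1) * |g x| ^ (p - 2)) • fderiv ℝ g x) x := fun x => by
    have := (hasDerivAt_abs_rpow_mul_self (by linarith : 0 < p - 2) (g x)).comp_hasFDerivAt x
      (hg x).hasFDerivAt
    rwa [show p - 2 + 1 = p - 1 by ring] at this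
  have hG' : ∀ x, fderiv ℝ G x y = (p - 1) * |g x| ^ (p - 2) * h x := fun x => by
    rw [(hGd x).fderiv]
    simp [hgh]
  have hgc := hg.continuous
  have hpow : Continuous fun x => |g x| ^ (p - 2) :=
    hgc.abs.rpow_const fun _ => Or.inr (by linarith)
  have hGc : Continuous G := hpow.mul hgc
  have hgs : HasCompactSupport g := by
    have := hfs.fderiv_apply ℝ y
    simpa only [hfg] using this
  have hparts := integral_mul_fderiv_eq_neg_fderiv_mul_of_integrable (μ := μ) (f := G) (g := f)
    (v := y)
    (by
      simp only [hG']
      exact (((continuous_const.mul hpow).mul hh).mul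
        hf.continuous).integrable_of_hasCompactSupport hfs.mul_left)
    (by
      simp only [hfg]
      exact (hGc.mul hgc).integrable_of_hasCompactSupport hgs.mul_left)
    ((hGc.mul hf.continuous).integrable_of_hasCompactSupport hfs.mul_left)
    (fun x _ => (hGd x).differentiableAt) (fun x _ => hf x)
  have hleft : ∀ x, |g x| ^ p = G x * fderiv ℝ f x y := fun x => by
    rw [hfg, hG, mul_assoc, ← abs_mul_abs_self (g x), ← sq, ← Real.rpow_natCast,
      ← Real.rpow_add_of_nonneg (abs_nonneg _) (by linarith) (by positivity)]
    norm_num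
  rw [integral_congr_ae (Filter.Eventually.of_forall hleft), hparts, ← integral_const_mul,
    ← integral_neg]
  refine integral_mono ?_ ?_ fun x => ?_
  · simp only [hG']
    exact ((((continuous_const.mul hpow).mul hh).mul
      hf.continuous).integrable_of_hasCompactSupport hfs.mul_left).neg
  · exact ((continuous_const.mul ((hf.continuous.abs.mul hpow).mul
      hh.abs))).integrable_of_hasCompactSupport ((hfs.abs.mul_right.mul_right).mul_left)
  · simp only [hG']
    refine (neg_le_abs _).trans (le_of_eq ?_)
    rw [abs_mul, abs_mul, abs_mul, abs_of_nonneg (by linarith : 0 ≤ p - 1),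
      abs_of_nonneg (by positivity : 0 ≤ |g x| ^ (p - 2))]
    ring

lemma hasFDerivAt_iteratedFDeriv_apply {E : Type*} [NormedAddCommGroup E] [NormedSpace ℝ E]
    {u : E → ℝ} (hu : ContDiff ℝ (⊤ : ℕ∞) u) (m : ℕ) (v : Fin m → E) (x y : E) :
    HasFDerivAt (fun x => iteratedFDeriv ℝ m u x v)
      ((ContinuousMultilinearMap.apply ℝ (fun _ : Fin m => E) ℝ v).comp
        (fderiv ℝ (iteratedFDeriv ℝ m u) x)) x ∧
    fderiv ℝ (fun x => iteratedFDeriv ℝ m u x v) x y =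
      iteratedFDeriv ℝ (m + 1) u x (Fin.cons y v) := by
  have hd := hu.differentiable_iteratedFDeriv (m := m) (by exact_mod_cast ENat.natCast_lt_top m)
  have h1 := (ContinuousMultilinearMap.apply ℝ (fun _ : Fin m => E) ℝ v).hasFDerivAt.comp x
    (hd x).hasFDerivAt
  refine ⟨h1, ?_⟩
  rw [iteratedFDeriv_succ_apply_left]
  have := congrArg (fun L => L y) h1.fderiv
  simpa [Function.comp_def] using this

section Interpolation

variable {n : ℕ} {u : EuclideanSpace ℝ (Fin n) → ℝ}

lemma continuous_norm_iteratedFDeriv (hu : ContDiff ℝ (⊤ : ℕ∞) u) (m : ℕ) :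
    Continuous fun x => ‖iteratedFDeriv ℝ m u x‖ :=
  (hu.continuous_iteratedFDeriv (by exact_mod_cast le_top)).norm

lemma integrable_norm_iteratedFDeriv_rpow (hu : ContDiff ℝ (⊤ : ℕ∞) u) (hus : HasCompactSupport u)
    (m : ℕ) {p : ℝ} (hp : 0 < p) : Integrable fun x => ‖iteratedFDeriv ℝ m u x‖ ^ p :=
  ((continuous_norm_iteratedFDeriv hu m).rpow_const
    fun _ => Or.inr hp.le).integrable_of_hasCompactSupport
    ((hus.iteratedFDeriv m).norm.comp_left (g := fun t : ℝ => t ^ p) (Real.zero_rpow hp.ne'))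

lemma abs_le_iSup_abs (hu : ContDiff ℝ (⊤ : ℕ∞) u) (hus : HasCompactSupport u)
    (x : EuclideanSpace ℝ (Fin n)) : |u x| ≤ ⨆ x, |u x| :=
  le_ciSup (f := fun x => |u x|)
    (hu.continuous.abs.bddAbove_range_of_hasCompactSupport hus.abs) x

lemma integral_norm_iteratedFDeriv_succ_rpow_le (hu : ContDiff ℝ (⊤ : ℕ∞) u)
    (hus : HasCompactSupport u) (m : ℕ) {p : ℝ} (hp : 2 < p) :
    ∫ x, ‖iteratedFDeriv ℝ (m + 1) u x‖ ^ p ≤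
      (#(univ : Finset (Fin (m + 1) → Fin n)) : ℝ) ^ (p - 1) *
        (#(univ : Finset (Fin (m + 1) → Fin n)) * (p - 1)) *
        ∫ x, ‖iteratedFDeriv ℝ m u x‖ * ‖iteratedFDeriv ℝ (m + 1) u x‖ ^ (p - 2) *
          ‖iteratedFDeriv ℝ (m + 2) u x‖ := by
  set e := EuclideanSpace.basisFun (Fin n) ℝ
  set N : ℝ := (#(univ : Finset (Fin (m + 1) → Fin n)) : ℝ)
  have hle : ∀ (l : ℕ) (v : Fin l → EuclideanSpace ℝ (Fin n)), (∀ i, ‖v i‖ ≤ 1) → ∀ x,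
      |iteratedFDeriv ℝ l u x v| ≤ ‖iteratedFDeriv ℝ l u x‖ := fun l v hv x => by
    simpa using (iteratedFDeriv ℝ l u x).le_opNorm_mul_prod_of_le hv
  have hcont : ∀ (l : ℕ) (v : Fin l → EuclideanSpace ℝ (Fin n)),
      Continuous fun x => iteratedFDeriv ℝ l u x v := fun l v =>
    continuous_iff_continuousAt.2 fun x =>
      (hasFDerivAt_iteratedFDeriv_apply hu l v x 0).1.continuousAt
  have hsupp : ∀ (l : ℕ) (v : Fin l → EuclideanSpace ℝ (Fin n)),
      HasCompactSupport fun x => iteratedFDeriv ℝ l u x v := fun l v =>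
    (hus.iteratedFDeriv (𝕜 := ℝ) l).comp_left (g := fun T : ContinuousMultilinearMap ℝ
      (fun _ : Fin l => EuclideanSpace ℝ (Fin n)) ℝ => T v) rfl
  have hp0 : 0 < p := by linarith
  have hword : ∀ α : Fin (m + 1) → Fin n,
      ∫ x, |iteratedFDeriv ℝ (m + 1) u x fun i => e (α i)| ^ p ≤
        (p - 1) * ∫ x, ‖iteratedFDeriv ℝ m u x‖ * ‖iteratedFDeriv ℝ (m + 1) u x‖ ^ (p - 2) *
          ‖iteratedFDeriv ℝ (m + 2) u x‖ := fun α => by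
    set v : Fin m → EuclideanSpace ℝ (Fin n) := fun i => e (α i.succ)
    set y := e (α 0)
    have hα : (fun i => e (α i)) = (Fin.cons y v : Fin (m + 1) → EuclideanSpace ℝ (Fin n)) := by
      ext1 i
      refine Fin.cases ?_ (fun i => ?_) i <;> rfl
    rw [hα]
    have hv0 : ∀ i, ‖v i‖ ≤ 1 := fun i => (e.orthonormal.1 _).le
    have hy0 : ‖y‖ ≤ 1 := (e.orthonormal.1 _).le
    have hv1 : ∀ i, ‖(Fin.cons y v : Fin (m + 1) → EuclideanSpace ℝ (Fin n)) i‖ ≤ 1 := fun i =>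
      Fin.cases hy0 hv0 i
    have hv2 : ∀ i, ‖(Fin.cons y (Fin.cons y v : Fin (m + 1) → EuclideanSpace ℝ (Fin n)) :
        Fin (m + 2) → EuclideanSpace ℝ (Fin n)) i‖ ≤ 1 := fun i => Fin.cases hy0 hv1 i
    refine (integral_abs_rpow_le_of_fderiv
      (fun x => (hasFDerivAt_iteratedFDeriv_apply hu m v x y).1.differentiableAt)
      (fun x => (hasFDerivAt_iteratedFDeriv_apply hu (m + 1) (Fin.cons y v) x y).1.differentiableAt)
      (hcont _ _) (fun x => (hasFDerivAt_iteratedFDeriv_apply hu m v x y).2)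
      (fun x => (hasFDerivAt_iteratedFDeriv_apply hu (m + 1) (Fin.cons y v) x y).2)
      (hsupp m v) hp).trans ?_
    refine mul_le_mul_of_nonneg_left ?_ (by linarith)
    have hexp : ∀ x : ℝ, x ≠ 0 ∨ 0 ≤ p - 2 := fun x => Or.inr (by linarith)
    refine integral_mono ?_ ?_ fun x => ?_
    · exact ((((hcont m v).abs.mul ((hcont (m + 1) _).abs.rpow_const fun _ => hexp _)).mul
        (hcont (m + 2) _).abs)).integrable_of_hasCompactSupport
        ((hsupp m v).abs.mul_right.mul_right)
    · exact ((((continuous_norm_iteratedFDeriv hu m).mul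
        ((continuous_norm_iteratedFDeriv hu (m + 1)).rpow_const fun _ => hexp _)).mul
        (continuous_norm_iteratedFDeriv hu (m + 2)))).integrable_of_hasCompactSupport
        ((hus.iteratedFDeriv m).norm.mul_right.mul_right)
    · have := hle m v hv0 x
      have := hle (m + 1) _ hv1 x
      have := hle (m + 2) _ hv2 x
      have : 0 ≤ p - 2 := by linarith
      dsimp only
      gcongr
  have hint : ∀ α : Fin (m + 1) → Fin n,
      Integrable fun x => |iteratedFDeriv ℝ (m + 1) u x fun i => e (α i)| ^ p := fun α =>
    ((hcont (m + 1) _).abs.rpow_const fun _ => Or.inr hp0.le).integrable_of_hasCompactSupport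
      ((hsupp (m + 1) _).abs.comp_left (g := fun t : ℝ => t ^ p) (Real.zero_rpow hp0.ne'))
  calc ∫ x, ‖iteratedFDeriv ℝ (m + 1) u x‖ ^ p
      ≤ ∫ x, N ^ (p - 1) * ∑ α : Fin (m + 1) → Fin n,
          |iteratedFDeriv ℝ (m + 1) u x fun i => e (α i)| ^ p := by
        refine integral_mono (integrable_norm_iteratedFDeriv_rpow hu hus (m + 1) hp0)
          ((integrable_finsetSum _ fun α _ => hint α).const_mul _) fun x => ?_
        exact (Real.rpow_le_rpow (norm_nonneg _) (norm_le_sum_norm_apply_basisFun _) hp0.le).trans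
          (Real.rpow_sum_le_const_mul_sum_rpow _ _ (by linarith))
    _ = N ^ (p - 1) * ∑ α : Fin (m + 1) → Fin n,
          ∫ x, |iteratedFDeriv ℝ (m + 1) u x fun i => e (α i)| ^ p := by
        rw [integral_const_mul, integral_finsetSum _ fun α _ => hint α]
    _ ≤ N ^ (p - 1) * (N * ((p - 1) * ∫ x, ‖iteratedFDeriv ℝ m u x‖ *
          ‖iteratedFDeriv ℝ (m + 1) u x‖ ^ (p - 2) * ‖iteratedFDeriv ℝ (m + 2) u x‖)) := by
        refine mul_le_mul_of_nonneg_left ?_ (by positivity)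
        refine (sum_le_sum fun α _ => hword α).trans (le_of_eq ?_)
        rw [sum_const, nsmul_eq_mul]
    _ = _ := by ring

/-- The norm of `∇ʲ u` in `L^{2r/j}`, to be read as the supremum of `|u|` for `j = 0`. -/
noncomputable def scaleNorm (u : EuclideanSpace ℝ (Fin n) → ℝ) (r j : ℕ) : ℝ :=
  if j = 0 then ⨆ x, |u x|
  else (∫ x, ‖iteratedFDeriv ℝ j u x‖ ^ (2 * (r : ℝ) / j)) ^ ((j : ℝ) / (2 * r))

lemma scaleNorm_nonneg (r j : ℕ) : 0 ≤ scaleNorm u r j := by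
  rw [scaleNorm]
  split_ifs
  · exact Real.iSup_nonneg fun x => abs_nonneg _
  · exact Real.rpow_nonneg (integral_nonneg fun x => by positivity) _

lemma integral_mul_rpow_mul_le_scaleNorm (hu : ContDiff ℝ (⊤ : ℕ∞) u)
    (hus : HasCompactSupport u) {m r : ℕ} (hmr : m + 2 ≤ r) :
    ∫ x, ‖iteratedFDeriv ℝ m u x‖ *
        ‖iteratedFDeriv ℝ (m + 1) u x‖ ^ (2 * (r : ℝ) / (m + 1 : ℕ) - 2) *
          ‖iteratedFDeriv ℝ (m + 2) u x‖ ≤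
      scaleNorm u r m * (∫ x, ‖iteratedFDeriv ℝ (m + 1) u x‖ ^ (2 * (r : ℝ) / (m + 1 : ℕ))) ^
        (1 - (m + 1 : ℕ) / (r : ℝ)) * scaleNorm u r (m + 2) := by
  have hr : (0 : ℝ) < r := by exact_mod_cast (by omega : 0 < r)
  have hmr' : (m : ℝ) + 2 ≤ r := by exact_mod_cast hmr
  set p : ℝ := 2 * (r : ℝ) / (m + 1 : ℕ) with hp
  set s : ℝ := 2 * (r : ℝ) / (m + 2 : ℕ) with hs
  have hp0 : 0 < p := by positivity
  have hs0 : 0 < s := by positivity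
  have hb : 0 ≤ 1 - (m + 1 : ℕ) / (r : ℝ) := by
    rw [sub_nonneg, div_le_one hr]
    push_cast
    linarith
  have I1 := integrable_norm_iteratedFDeriv_rpow hu hus (m + 1) hp0
  have I2 := integrable_norm_iteratedFDeriv_rpow hu hus (m + 2) hs0
  have e1 : ∀ x, (‖iteratedFDeriv ℝ (m + 1) u x‖ ^ p) ^ (1 - (m + 1 : ℕ) / (r : ℝ)) =
      ‖iteratedFDeriv ℝ (m + 1) u x‖ ^ (p - 2) := fun x => by
    rw [← Real.rpow_mul (norm_nonneg _)]
    congr 1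
    rw [hp]
    push_cast
    field_simp
  have e2 : ∀ x, (‖iteratedFDeriv ℝ (m + 2) u x‖ ^ s) ^ ((m + 2 : ℕ) / (2 * (r : ℝ))) =
      ‖iteratedFDeriv ℝ (m + 2) u x‖ := fun x => by
    rw [← Real.rpow_mul (norm_nonneg _), hs]
    convert Real.rpow_one _ using 2
    push_cast
    field_simp
  have hscale : scaleNorm u r (m + 2) =
      (∫ x, ‖iteratedFDeriv ℝ (m + 2) u x‖ ^ s) ^ ((m + 2 : ℕ) / (2 * (r : ℝ))) := by
    simp [scaleNorm, hs]
  rw [hscale]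
  rcases Nat.eq_zero_or_pos m with rfl | hm
  · have key := integral_rpow_mul_rpow_mul_rpow_le I1 I1 I2 (fun x => by positivity)
      (fun x => by positivity) (fun x => by positivity) le_rfl hb
      (by positivity : 0 ≤ ((0 + 2 : ℕ) : ℝ) / (2 * (r : ℝ))) (by push_cast; field_simp; ring)
    simp only [e1, e2, Real.rpow_zero, one_mul] at key
    have h0 : scaleNorm u r 0 = ⨆ x, |u x| := by simp [scaleNorm]
    have hexp : 0 ≤ p - 2 := by
      rw [hp, sub_nonneg, le_div_iff₀ (by positivity)]
      push_cast at hmr' ⊢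
      linarith
    have hc1 := (continuous_norm_iteratedFDeriv hu (0 + 1)).rpow_const (p := p - 2)
      fun _ => Or.inr hexp
    have hc2 := continuous_norm_iteratedFDeriv hu (0 + 2)
    have hs2 := (hus.iteratedFDeriv (𝕜 := ℝ) (0 + 2)).norm
    rw [mul_assoc, h0]
    refine le_trans ?_ (mul_le_mul_of_nonneg_left key (Real.iSup_nonneg fun x => abs_nonneg (u x)))
    rw [← integral_const_mul]
    refine integral_mono ?_ ?_ fun x => ?_
    · exact (((continuous_norm_iteratedFDeriv hu 0).mul hc1).mul
        hc2).integrable_of_hasCompactSupport hs2.mul_left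
    · exact (continuous_const.mul (hc1.mul hc2)).integrable_of_hasCompactSupport
        hs2.mul_left.mul_left
    · have := abs_le_iSup_abs hu hus x
      dsimp only
      rw [norm_iteratedFDeriv_zero, mul_assoc, Real.norm_eq_abs]
      gcongr
  · have hm0 : (0 : ℝ) < m := by exact_mod_cast hm
    set q : ℝ := 2 * (r : ℝ) / m with hq
    have I0 := integrable_norm_iteratedFDeriv_rpow hu hus m (by positivity : 0 < q)
    have e0 : ∀ x, (‖iteratedFDeriv ℝ m u x‖ ^ q) ^ ((m : ℝ) / (2 * (r : ℝ))) =
        ‖iteratedFDeriv ℝ m u x‖ := fun x => by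
      rw [← Real.rpow_mul (norm_nonneg _), hq]
      convert Real.rpow_one _ using 2
      field_simp
    have key := integral_rpow_mul_rpow_mul_rpow_le I0 I1 I2 (fun x => by positivity)
      (fun x => by positivity) (fun x => by positivity)
      (by positivity : 0 ≤ (m : ℝ) / (2 * (r : ℝ))) hb
      (by positivity : 0 ≤ ((m + 2 : ℕ) : ℝ) / (2 * (r : ℝ))) (by push_cast; field_simp; ring)
    simp only [e0, e1, e2] at key
    simpa [scaleNorm, hm.ne', ← hq] using key

lemma exists_scaleNorm_succ_sq_le (n : ℕ) {m r : ℕ} (hmr : m + 2 ≤ r) :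
    ∃ K > 0, ∀ u : EuclideanSpace ℝ (Fin n) → ℝ, ContDiff ℝ (⊤ : ℕ∞) u → HasCompactSupport u →
      scaleNorm u r (m + 1) ^ 2 ≤ K * (scaleNorm u r m * scaleNorm u r (m + 2)) := by
  have hr : (0 : ℝ) < r := by exact_mod_cast (by omega : 0 < r)
  have hmr' : (m : ℝ) + 2 ≤ r := by exact_mod_cast hmr
  set p : ℝ := 2 * (r : ℝ) / (m + 1 : ℕ) with hp
  have hp2 : 2 < p := by
    rw [hp, lt_div_iff₀ (by positivity)]
    push_cast
    linarith
  set K : ℝ := (#(univ : Finset (Fin (m + 1) → Fin n)) : ℝ) ^ (p - 1) *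
    (#(univ : Finset (Fin (m + 1) → Fin n)) * (p - 1)) with hK
  have hK0 : 0 ≤ K := by
    have : 0 ≤ p - 1 := by linarith
    positivity
  refine ⟨K + 1, by positivity, fun u hu hus => ?_⟩
  have h1 := integral_norm_iteratedFDeriv_succ_rpow_le hu hus m hp2
  have h2 := integral_mul_rpow_mul_le_scaleNorm hu hus hmr
  rw [← hp] at h2
  rw [← hK] at h1
  set X := ∫ x, ‖iteratedFDeriv ℝ (m + 1) u x‖ ^ p with hX
  have hX0 : 0 ≤ X := integral_nonneg fun x => by positivity
  have b0 := scaleNorm_nonneg (u := u) r m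
  have b2 := scaleNorm_nonneg (u := u) r (m + 2)
  have hsq : scaleNorm u r (m + 1) ^ 2 = X ^ (((m + 1 : ℕ) : ℝ) / r) := by
    rw [scaleNorm, if_neg (by omega), ← Real.rpow_natCast, ← hp, ← hX, ← Real.rpow_mul hX0]
    congr 1
    push_cast
    field_simp
  rw [hsq]
  rcases hX0.eq_or_lt with h0 | hpos
  · rw [← h0, Real.zero_rpow (by positivity)]
    positivity
  · refine le_of_mul_le_mul_right ?_ (Real.rpow_pos_of_pos hpos (1 - ((m + 1 : ℕ) : ℝ) / r))
    rw [← Real.rpow_add hpos, add_sub_cancel, Real.rpow_one]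
    calc X ≤ K * _ := h1
      _ ≤ (K + 1) * _ := mul_le_mul (by linarith) h2
          (integral_nonneg fun x => by positivity) (by positivity)
      _ = _ := by ring

/-- The sum of the `L²` norms of the derivatives up to order `r`. -/
noncomputable def sobolevNorm (u : EuclideanSpace ℝ (Fin n) → ℝ) (r : ℕ) : ℝ :=
  ∑ i ∈ Finset.range (r + 1), (∫ x, ‖iteratedFDeriv ℝ i u x‖ ^ 2) ^ ((1 : ℝ) / 2)

lemma rpow_half_le_sobolevNorm {r i : ℕ} (hi : i ≤ r) :
    (∫ x, ‖iteratedFDeriv ℝ i u x‖ ^ 2) ^ ((1 : ℝ) / 2) ≤ sobolevNorm u r :=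
  single_le_sum (f := fun i => (∫ x, ‖iteratedFDeriv ℝ i u x‖ ^ 2) ^ ((1 : ℝ) / 2))
    (fun _ _ => Real.rpow_nonneg (integral_nonneg fun _ => by positivity) _)
    (mem_range.2 (by omega))

lemma exists_scaleNorm_le (n : ℕ) {j r : ℕ} (hj : 1 ≤ j) (hjr : j ≤ r) :
    ∃ C > 0, ∀ u : EuclideanSpace ℝ (Fin n) → ℝ, ContDiff ℝ (⊤ : ℕ∞) u → HasCompactSupport u →
      scaleNorm u r j ≤
        C * ((⨆ x, |u x|) ^ (1 - (j : ℝ) / r) * sobolevNorm u r ^ ((j : ℝ) / r)) := by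
  have hK : ∀ m, ∃ K > 0, m + 2 ≤ r → ∀ u : EuclideanSpace ℝ (Fin n) → ℝ,
      ContDiff ℝ (⊤ : ℕ∞) u → HasCompactSupport u →
      scaleNorm u r (m + 1) ^ 2 ≤ K * (scaleNorm u r m * scaleNorm u r (m + 2)) := fun m => by
    by_cases hm : m + 2 ≤ r
    · obtain ⟨K, hK, h⟩ := exists_scaleNorm_succ_sq_le n hm
      exact ⟨K, hK, fun _ => h⟩
    · exact ⟨1, one_pos, fun h => absurd h hm⟩
  choose K hK0 hK using hK
  have hpos : 0 < ∑ m ∈ range (r + 1), K m := sum_pos (fun m _ => hK0 m) (by simp)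
  obtain ⟨C, hC, h⟩ := exists_le_rpow_mul_rpow_of_sq_le hpos hj hjr
  refine ⟨C, hC, fun u hu hus => ?_⟩
  refine (h (scaleNorm u r) (scaleNorm_nonneg r) fun i hi => ?_).trans ?_
  · refine (hK i hi u hu hus).trans (mul_le_mul_of_nonneg_right ?_
      (mul_nonneg (scaleNorm_nonneg r i) (scaleNorm_nonneg r (i + 2))))
    exact single_le_sum (fun m _ => (hK0 m).le) (mem_range.2 (by omega))
  · have hr0 : r ≠ 0 := by omega
    have hr : (r : ℝ) ≠ 0 := by exact_mod_cast hr0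
    have h0 : scaleNorm u r 0 = ⨆ x, |u x| := by simp [scaleNorm]
    have hsr : scaleNorm u r r ≤ sobolevNorm u r := by
      refine le_trans (le_of_eq ?_) (rpow_half_le_sobolevNorm le_rfl)
      have e1 : 2 * (r : ℝ) / r = (2 : ℕ) := by push_cast; field_simp
      have e2 : (r : ℝ) / (2 * r) = 1 / 2 := by field_simp
      rw [scaleNorm, if_neg hr0, e1, e2]
      simp only [Real.rpow_natCast]
    have := scaleNorm_nonneg (u := u) r r
    have : 0 ≤ ⨆ x, |u x| := Real.iSup_nonneg fun x => abs_nonneg (u x)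
    rw [h0]
    gcongr

lemma exists_integral_rpow_le (n : ℕ) {j k r : ℕ} (hk : 1 ≤ k) (hjk : j ≤ k) (hkr : k ≤ r) :
    ∃ C > 0, ∀ u : EuclideanSpace ℝ (Fin n) → ℝ, ContDiff ℝ (⊤ : ℕ∞) u → HasCompactSupport u →
      (∫ x, ‖iteratedFDeriv ℝ j u x‖ ^ ((2 * (r : ℝ)) / (k : ℝ))) ^ ((k : ℝ) / (2 * (r : ℝ))) ≤
        C * ((⨆ x, |u x|) ^ (1 - (k : ℝ) / r) * sobolevNorm u r ^ ((k : ℝ) / r)) := by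
  have hk0 : (0 : ℝ) < k := by exact_mod_cast hk
  have hkr' : (k : ℝ) ≤ r := by exact_mod_cast hkr
  have hr0 : (0 : ℝ) < r := hk0.trans_le hkr'
  rcases Nat.eq_zero_or_pos j with rfl | hj
  · refine ⟨1, one_pos, fun u hu hus => ?_⟩
    set M := ⨆ x, |u x| with hM
    have hM0 : 0 ≤ M := Real.iSup_nonneg fun x => abs_nonneg (u x)
    set q : ℝ := 2 * (r : ℝ) / k with hq
    have hq2 : 0 ≤ q - 2 := by
      rw [hq, sub_nonneg, le_div_iff₀ hk0]
      linarith
    have hP : 0 ≤ ∫ x, ‖iteratedFDeriv ℝ 0 u x‖ ^ 2 := integral_nonneg fun x => by positivity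
    have h1 : ∫ x, ‖iteratedFDeriv ℝ 0 u x‖ ^ q ≤
        M ^ (q - 2) * ∫ x, ‖iteratedFDeriv ℝ 0 u x‖ ^ 2 := by
      rw [← integral_const_mul]
      refine integral_mono (integrable_norm_iteratedFDeriv_rpow hu hus 0 (by positivity)) ?_
        fun x => ?_
      · have := integrable_norm_iteratedFDeriv_rpow hu hus 0 (p := (2 : ℕ)) (by norm_num)
        simp only [Real.rpow_natCast] at this
        exact this.const_mul _
      · have hx : ‖iteratedFDeriv ℝ 0 u x‖ ≤ M := by
          rw [norm_iteratedFDeriv_zero]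
          exact abs_le_iSup_abs hu hus x
        dsimp only
        rw [← Real.rpow_natCast, show q = (q - 2) + (2 : ℕ) by push_cast; ring,
          Real.rpow_add_of_nonneg (norm_nonneg _) hq2 (by positivity), add_sub_assoc,
          show ((2 : ℕ) : ℝ) - 2 = 0 by norm_num, add_zero]
        gcongr
    calc _ ≤ (M ^ (q - 2) * ∫ x, ‖iteratedFDeriv ℝ 0 u x‖ ^ 2) ^ ((k : ℝ) / (2 * (r : ℝ))) :=
          Real.rpow_le_rpow (integral_nonneg fun x => by positivity) h1 (by positivity)
      _ = M ^ (1 - (k : ℝ) / r) *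
          ((∫ x, ‖iteratedFDeriv ℝ 0 u x‖ ^ 2) ^ ((1 : ℝ) / 2)) ^ ((k : ℝ) / r) := by
          rw [Real.mul_rpow (by positivity) hP, ← Real.rpow_mul hM0, ← Real.rpow_mul hP]
          congr 2
          · rw [hq]
            field_simp
          · field_simp
      _ ≤ 1 * (M ^ (1 - (k : ℝ) / r) * sobolevNorm u r ^ ((k : ℝ) / r)) := by
          rw [one_mul]
          have := rpow_half_le_sobolevNorm (u := u) (Nat.zero_le r)
          gcongr
  · obtain ⟨C, hC, h⟩ := exists_scaleNorm_le n hj (hjk.trans hkr)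
    rcases hjk.eq_or_lt with rfl | hlt
    · refine ⟨C, hC, fun u hu hus => ?_⟩
      have := h u hu hus
      rwa [scaleNorm, if_neg (by omega)] at this
    have hj0 : (0 : ℝ) < j := by exact_mod_cast hj
    have hjk' : (j : ℝ) < k := by exact_mod_cast hlt
    have hrj : 0 < (r : ℝ) - j := by linarith
    obtain ⟨t, ht⟩ : ∃ t : ℝ, t = (k - j) / (r - j) := ⟨_, rfl⟩
    have ht0 : 0 ≤ t := by
      rw [ht]
      exact div_nonneg (by linarith) hrj.le
    have ht1 : 0 ≤ 1 - t := by
      rw [ht, sub_nonneg, div_le_one hrj]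
      linarith
    have htk : t * (r - j) = k - j := by
      rw [ht]
      field_simp
    refine ⟨C ^ (1 - t), by positivity, fun u hu hus => ?_⟩
    set M := ⨆ x, |u x| with hM
    have hM0 : 0 ≤ M := Real.iSup_nonneg fun x => abs_nonneg (u x)
    have hP : 0 ≤ ∫ x, ‖iteratedFDeriv ℝ j u x‖ ^ 2 := integral_nonneg fun x => by positivity
    have hS := rpow_half_le_sobolevNorm (u := u) (hjk.trans hkr)
    have hS0 : 0 ≤ sobolevNorm u r := (Real.rpow_nonneg hP _).trans hS
    set q : ℝ := 2 * (r : ℝ) / j with hq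
    have hX : 0 ≤ ∫ x, ‖iteratedFDeriv ℝ j u x‖ ^ q := integral_nonneg fun x => by positivity
    have I1 := integrable_norm_iteratedFDeriv_rpow hu hus j (p := q) (by positivity)
    have I2 : Integrable fun x => ‖iteratedFDeriv ℝ j u x‖ ^ 2 := by
      have := integrable_norm_iteratedFDeriv_rpow hu hus j (p := (2 : ℕ)) (by norm_num)
      simpa only [Real.rpow_natCast] using this
    have key := integral_rpow_mul_rpow_mul_rpow_le I1 I1 I2 (fun x => by positivity)
      (fun x => by positivity) (fun x => by positivity) le_rfl
      (by positivity : 0 ≤ (1 - t) * j / k) (by positivity : 0 ≤ t * r / k)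
      (by field_simp; linarith)
    have e : ∀ x, (‖iteratedFDeriv ℝ j u x‖ ^ q) ^ ((1 - t) * j / k) *
        (‖iteratedFDeriv ℝ j u x‖ ^ 2) ^ (t * r / k) =
          ‖iteratedFDeriv ℝ j u x‖ ^ ((2 * (r : ℝ)) / (k : ℝ)) := fun x => by
      rw [← Real.rpow_natCast, ← Real.rpow_mul (norm_nonneg _), ← Real.rpow_mul (norm_nonneg _),
        ← Real.rpow_add_of_nonneg (norm_nonneg _) (by positivity) (by positivity)]
      congr 1
      rw [hq]
      push_cast
      field_simp
      ring
    simp only [Real.rpow_zero, one_mul, e] at key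
    have hj' := h u hu hus
    rw [scaleNorm, if_neg (by omega), ← hq, ← hM] at hj'
    calc _ ≤ ((∫ x, ‖iteratedFDeriv ℝ j u x‖ ^ q) ^ ((1 - t) * j / k) *
          (∫ x, ‖iteratedFDeriv ℝ j u x‖ ^ 2) ^ (t * r / k)) ^ ((k : ℝ) / (2 * (r : ℝ))) :=
          Real.rpow_le_rpow (integral_nonneg fun x => by positivity) key (by positivity)
      _ = ((∫ x, ‖iteratedFDeriv ℝ j u x‖ ^ q) ^ ((j : ℝ) / (2 * r))) ^ (1 - t) *
          ((∫ x, ‖iteratedFDeriv ℝ j u x‖ ^ 2) ^ ((1 : ℝ) / 2)) ^ t := by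
          rw [Real.mul_rpow (by positivity) (by positivity), ← Real.rpow_mul hX,
            ← Real.rpow_mul hX, ← Real.rpow_mul hP, ← Real.rpow_mul hP]
          congr 2 <;> field_simp
      _ ≤ (C * (M ^ (1 - (j : ℝ) / r) * sobolevNorm u r ^ ((j : ℝ) / r))) ^ (1 - t) *
          sobolevNorm u r ^ t := by gcongr
      _ = C ^ (1 - t) * (M ^ ((1 - (j : ℝ) / r) * (1 - t)) *
          (sobolevNorm u r ^ ((j : ℝ) / r * (1 - t)) * sobolevNorm u r ^ t)) := by
          rw [Real.mul_rpow hC.le (by positivity), Real.mul_rpow (by positivity) (by positivity),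
            ← Real.rpow_mul hM0, ← Real.rpow_mul hS0]
          ring
      _ = _ := by
          rw [← Real.rpow_add_of_nonneg hS0 (by positivity) ht0]
          congr 3
          · field_simp
            linarith
          · field_simp
            linarith

end Interpolation

theorem stmt19 (n : ℕ) (hn : 1 ≤ n) (k r : ℕ) (hk : 1 ≤ k) (hkr : k ≤ r) :
    ∃ C > 0, ∀ u : EuclideanSpace ℝ (Fin n) → ℝ,
      ContDiff ℝ (⊤ : ℕ∞) u → HasCompactSupport u →
      ∑ j ∈ Finset.range (k + 1),
          (∫ x, ‖iteratedFDeriv ℝ j u x‖ ^ ((2 * (r : ℝ)) / (k : ℝ))) ^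
            ((k : ℝ) / (2 * (r : ℝ))) ≤
        C * (⨆ x, |u x|) ^ (1 - (k : ℝ) / (r : ℝ)) *
          (∑ i ∈ Finset.range (r + 1),
            (∫ x, ‖iteratedFDeriv ℝ i u x‖ ^ 2) ^ ((1 : ℝ) / 2)) ^ ((k : ℝ) / (r : ℝ)) := by
  have hC : ∀ j, ∃ C > 0, j ≤ k → ∀ u : EuclideanSpace ℝ (Fin n) → ℝ,
      ContDiff ℝ (⊤ : ℕ∞) u → HasCompactSupport u →
      (∫ x, ‖iteratedFDeriv ℝ j u x‖ ^ ((2 * (r : ℝ)) / (k : ℝ))) ^ ((k : ℝ) / (2 * (r : ℝ))) ≤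
        C * ((⨆ x, |u x|) ^ (1 - (k : ℝ) / r) * sobolevNorm u r ^ ((k : ℝ) / r)) := fun j => by
    by_cases hj : j ≤ k
    · obtain ⟨C, hC, h⟩ := exists_integral_rpow_le n hk hj hkr
      exact ⟨C, hC, fun _ => h⟩
    · exact ⟨1, one_pos, fun h => absurd h hj⟩
  choose C hC0 hC using hC
  refine ⟨∑ j ∈ range (k + 1), C j, sum_pos (fun j _ => hC0 j) (by simp), fun u hu hus => ?_⟩
  rw [mul_assoc, sum_mul]
  exact sum_le_sum fun j hj => hC j (by simpa [Nat.lt_succ_iff] using hj) u hu hus
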